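/- Let a be a nonzero proper squarefree monomial ideal in R = k[x_1,...,x_n] over a field k. Then ρ̂(a^(•), overline(a^•)) = ρ̂((a^∨)^(•), overline((a^∨)^•)). -/

import Mathlib

open Filter Pointwise MvPolynomial

noncomputable section

/-- A graded family of ideals: `a p * a q ⊆ a (p+q)` for all `p, q ≥ 1`. -/
def IsGradedFamily {R : Type*} [CommSemiring R] (a : ℕ → Ideal R) : Prop :=
  ∀ p q : ℕ, 1 ≤ p → 1 ≤ q → a p * a q ≤ a (p + q)

/-- The integral closure of an ideal `J`: elements `x` satisfying an equation
`x^m + c_1 x^{m-1} + ⋯ + c_m = 0` with `c_i ∈ J^i`. -/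
def idealIntegralClosure {R : Type*} [CommRing R] (J : Ideal R) : Set R :=
  {x | ∃ m : ℕ, 0 < m ∧ ∃ c : ℕ → R,
    (∀ i ∈ Finset.Icc 1 m, c i ∈ J ^ i) ∧
    x ^ m + ∑ i ∈ Finset.Icc 1 m, c i * x ^ (m - i) = 0}

/-- The asymptotic resurgence
`ρ̂(a_•, B_•) = sup{s/r : s,r ≥ 1, a_{st} ⊄ B_{rt} for all t ≫ 0}` (in `EReal`, so that
the supremum of the empty set is `⊥ = -∞`); the second family is a family of subsets. -/
def asymptoticResurgence {R : Type*} [CommSemiring R] (a : ℕ → Ideal R) (B : ℕ → Set R) :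
    EReal :=
  sSup {x : EReal | ∃ s r : ℕ, 1 ≤ s ∧ 1 ≤ r ∧
    (∀ᶠ t in atTop, ¬ ((a (s * t) : Set R) ⊆ B (r * t))) ∧
    x = (((s : ℝ) / (r : ℝ) : ℝ) : EReal)}

/-- Usual dot product on `ℝⁿ`. -/
def dotProd {n : ℕ} (a b : Fin n → ℝ) : ℝ := ∑ i, a i * b i

/-- The polar set `D° = {a : ⟨a,b⟩ ≥ 1 for all b ∈ D}`. -/
def polarSet {n : ℕ} (D : Set (Fin n → ℝ)) : Set (Fin n → ℝ) :=
  {a | ∀ b ∈ D, 1 ≤ dotProd a b}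

/-- `sup{λ > 0 : λ·A ⊄ B}` as an extended real (`sup ∅ = -∞`). -/
def supScaleNotSubset {n : ℕ} (A B : Set (Fin n → ℝ)) : EReal :=
  sSup {x : EReal | ∃ l : ℝ, 0 < l ∧ ¬ (l • A ⊆ B) ∧ x = ((l : ℝ) : EReal)}

variable {𝕜 : Type*} [Field 𝕜] {n : ℕ}

/-- A monomial ideal: an ideal generated by monomials. -/
def IsMonomialIdeal (I : Ideal (MvPolynomial (Fin n) 𝕜)) : Prop :=
  ∃ S : Set (Fin n →₀ ℕ), I = Ideal.span ((fun d => monomial d (1 : 𝕜)) '' S)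

/-- The Newton polyhedron `NP(I) = conv{d ∈ ℤⁿ_{≥0} : x^d ∈ I}`. -/
def newtonPolyhedron (I : Ideal (MvPolynomial (Fin n) 𝕜)) : Set (Fin n → ℝ) :=
  convexHull ℝ {x | ∃ d : Fin n →₀ ℕ, monomial d (1 : 𝕜) ∈ I ∧ x = fun i => (d i : ℝ)}

/-- The Newton–Okounkov body `Δ(a_•) = closure (⋃_{k ≥ 1} (1/k)·NP(a_k))`. -/
def noBody (a : ℕ → Ideal (MvPolynomial (Fin n) 𝕜)) : Set (Fin n → ℝ) :=
  closure (⋃ k : ℕ, ⋃ (_ : 1 ≤ k), (k : ℝ)⁻¹ • newtonPolyhedron (a k))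

/-- A squarefree monomial ideal: an ideal generated by squarefree monomials. -/
def IsSqfreeMonomialIdeal (I : Ideal (MvPolynomial (Fin n) 𝕜)) : Prop :=
  ∃ S : Set (Finset (Fin n)), I = Ideal.span ((fun s => ∏ i ∈ s, X i) '' S)

open Classical in
/-- The symbolic polyhedron
`SP(I) = ⋂_{p ∈ Ass(R/I)} {a ∈ ℝⁿ_{≥0} : Σ_{x_i ∈ p} a_i ≥ 1}`. -/
def symbolicPolyhedron (I : Ideal (MvPolynomial (Fin n) 𝕜)) : Set (Fin n → ℝ) :=
  ⋂ p ∈ associatedPrimes (MvPolynomial (Fin n) 𝕜) (MvPolynomial (Fin n) 𝕜 ⧸ I),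
    {a | (∀ i, 0 ≤ a i) ∧ 1 ≤ ∑ i : Fin n, if X i ∈ p then a i else 0}

open Classical in
/-- The Alexander dual `I^∨ = (∏_{x_i ∈ p} x_i : p ∈ Ass(R/I))`. -/
def alexanderDual (I : Ideal (MvPolynomial (Fin n) 𝕜)) : Ideal (MvPolynomial (Fin n) 𝕜) :=
  Ideal.span {f | ∃ p ∈ associatedPrimes (MvPolynomial (Fin n) 𝕜) (MvPolynomial (Fin n) 𝕜 ⧸ I),
    f = ∏ i ∈ Finset.univ.filter (fun i => X i ∈ p), X i}

/-- The `m`-th symbolic power `I^{(m)} = ⋂_{p ∈ Ass(R/I)} p^m`. -/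
def symbolicPower (I : Ideal (MvPolynomial (Fin n) 𝕜)) (m : ℕ) : Ideal (MvPolynomial (Fin n) 𝕜) :=
  ⨅ p ∈ associatedPrimes (MvPolynomial (Fin n) 𝕜) (MvPolynomial (Fin n) 𝕜 ⧸ I), p ^ m

/-! ### Nonnegative weights on a family of finite sets -/

/-- The nonnegative vectors whose sum over each member of `S` is at least one. -/
def coveringWeights {n : ℕ} (S : Set (Finset (Fin n))) : Set (Fin n → ℝ) :=
  {y | (∀ i, 0 ≤ y i) ∧ ∀ E ∈ S, 1 ≤ ∑ i ∈ E, y i}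

/-- A point on which every covering weight is at least one dominates a convex combination of
indicator vectors of members of the family. -/
theorem exists_convexCombination_indicator_le {n : ℕ} {S : Set (Finset (Fin n))}
    {u : Fin n → ℝ} (hu : ∀ i, 0 ≤ u i)
    (h : ∀ y ∈ coveringWeights S, 1 ≤ ∑ i, u i * y i) :
    ∃ (ι : Type) (_ : Fintype ι) (w : ι → ℝ) (E : ι → Finset (Fin n)),
      (∀ j, 0 ≤ w j) ∧ ∑ j, w j = 1 ∧ (∀ j, E j ∈ S) ∧
      ∀ i, ∑ j, (if i ∈ E j then w j else 0) ≤ u i := by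
  classical
  let ind : Finset (Fin n) → Fin n → ℝ := fun E i => if i ∈ E then 1 else 0
  by_cases hd : Disjoint (Set.Iic u) (convexHull ℝ (ind '' S))
  · exfalso
    obtain ⟨f, α, β, hα, hαβ, hβ⟩ := geometric_hahn_banach_closed_compact (convex_Iic u)
      isClosed_Iic (convex_convexHull ℝ (ind '' S))
      ((S.toFinite.image ind).isCompact_convexHull (𝕜 := ℝ)) hd
    set y : Fin n → ℝ := fun i => f (Pi.single i 1) with hy
    have hf : ∀ v : Fin n → ℝ, f v = ∑ i, v i * y i := by
      intro v
      conv_lhs => rw [pi_eq_sum_univ' v]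
      simp only [map_sum, map_smul, smul_eq_mul, hy]
    have hy0 : ∀ i, 0 ≤ y i := by
      intro i
      by_contra! hi
      have hfu := hα u Set.self_mem_Iic
      have := hα (u - ((α - f u) / (-y i)) • Pi.single i (1 : ℝ)) (by
        simp only [Set.mem_Iic, sub_le_self_iff]
        exact smul_nonneg (div_nonneg (by linarith) (by linarith))
          (by simp [Pi.single_nonneg]))
      rw [map_sub, map_smul, smul_eq_mul] at this
      change f u - (α - f u) / (-y i) * y i < α at this
      have h2 : (α - f u) / (-y i) * y i = -(α - f u) := by
        rw [div_mul_eq_mul_div, div_neg, mul_div_cancel_right₀ _ hi.ne]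
      linarith
    have hfu0 : 0 ≤ f u := by
      rw [hf]
      exact Finset.sum_nonneg fun i _ => mul_nonneg (hu i) (hy0 i)
    have hfu := hα u Set.self_mem_Iic
    have hβ0 : 0 < β := by linarith
    have hmem : (fun i => y i / β) ∈ coveringWeights S := by
      refine ⟨fun i => div_nonneg (hy0 i) hβ0.le, fun E hE => ?_⟩
      have := hβ (ind E) (subset_convexHull ℝ _ ⟨E, hE, rfl⟩)
      rw [hf] at this
      rw [← Finset.sum_div, le_div_iff₀ hβ0, one_mul]
      refine this.le.trans (le_of_eq ?_)
      simp [ind]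
    have := h _ hmem
    simp only [← mul_div_assoc] at this
    rw [← Finset.sum_div, le_div_iff₀ hβ0, one_mul, ← hf] at this
    linarith
  · obtain ⟨z, hzu, hz⟩ := Set.not_disjoint_iff.1 hd
    rw [mem_convexHull_iff_exists_fintype] at hz
    obtain ⟨ι, hι, w, a, hw0, hw1, ha, rfl⟩ := hz
    choose E hE hEa using ha
    refine ⟨ι, hι, w, E, hw0, hw1, hE, fun i => ?_⟩
    refine le_trans (le_of_eq ?_) (hzu i)
    simp [← hEa, ind, Finset.sum_apply]

/-! ### Ideals of polynomials of bounded weighted order -/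

/-- The polynomials all of whose monomials have `y`-weight at least `c`. -/
def weightIdeal (𝕜 : Type*) [Field 𝕜] {n : ℕ} (y : Fin n → ℝ) (hy : ∀ i, 0 ≤ y i) (c : ℝ) :
    Ideal (MvPolynomial (Fin n) 𝕜) where
  carrier := {f | ∀ u ∈ f.support, c ≤ ∑ i, (u i : ℝ) * y i}
  zero_mem' := by simp
  add_mem' := by
    classical
    intro f g hf hg u hu
    rcases Finset.mem_union.1 (support_add hu) with h | h
    exacts [hf u h, hg u h]
  smul_mem' := by
    classical
    intro g f hf u hu
    obtain ⟨v, -, w, hw, rfl⟩ := Finset.mem_add.1 (support_mul g f hu)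
    have hv : 0 ≤ ∑ i, (v i : ℝ) * y i :=
      Finset.sum_nonneg fun i _ => mul_nonneg (Nat.cast_nonneg _) (hy i)
    have := hf w hw
    simp only [Finsupp.add_apply, Nat.cast_add, add_mul, Finset.sum_add_distrib]
    linarith

theorem mem_weightIdeal {y : Fin n → ℝ} {hy : ∀ i, 0 ≤ y i} {c : ℝ}
    {f : MvPolynomial (Fin n) 𝕜} :
    f ∈ weightIdeal 𝕜 y hy c ↔ ∀ u ∈ f.support, c ≤ ∑ i, (u i : ℝ) * y i := Iff.rfl

theorem weightIdeal_mul_le {y : Fin n → ℝ} {hy : ∀ i, 0 ≤ y i} (c d : ℝ) :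
    weightIdeal 𝕜 y hy c * weightIdeal 𝕜 y hy d ≤ weightIdeal 𝕜 y hy (c + d) := by
  classical
  rw [Ideal.mul_le]
  intro f hf g hg u hu
  obtain ⟨v, hv, w, hw, rfl⟩ := Finset.mem_add.1 (support_mul f g hu)
  have h1 := hf v hv
  have h2 := hg w hw
  simp only [Finsupp.add_apply, Nat.cast_add, add_mul, Finset.sum_add_distrib]
  linarith

theorem pow_le_weightIdeal {y : Fin n → ℝ} {hy : ∀ i, 0 ≤ y i} {c : ℝ}
    {I : Ideal (MvPolynomial (Fin n) 𝕜)} (hI : I ≤ weightIdeal 𝕜 y hy c) (k : ℕ) :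
    I ^ k ≤ weightIdeal 𝕜 y hy (k * c) := by
  induction k with
  | zero =>
    intro f _ u _
    simp only [Nat.cast_zero, zero_mul]
    exact Finset.sum_nonneg fun i _ => mul_nonneg (Nat.cast_nonneg _) (hy i)
  | succ k ih =>
    rw [pow_succ]
    refine (Ideal.mul_mono ih hI).trans ((weightIdeal_mul_le _ _).trans (le_of_eq ?_))
    push_cast
    ring_nf

/-- The exponent of a monomial integral over an ideal has at least the weight of that ideal. -/
theorem le_weight_of_monomial_mem_idealIntegralClosure {y : Fin n → ℝ} {hy : ∀ i, 0 ≤ y i}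
    {c : ℝ} {J : Ideal (MvPolynomial (Fin n) 𝕜)} (hJ : J ≤ weightIdeal 𝕜 y hy c)
    {d : Fin n →₀ ℕ} (hd : monomial d (1 : 𝕜) ∈ idealIntegralClosure J) :
    c ≤ ∑ i, (d i : ℝ) * y i := by
  obtain ⟨m, -, e, he, hsum⟩ := hd
  have hc := congrArg (coeff (m • d)) hsum
  rw [coeff_add, monomial_pow, coeff_monomial, if_pos rfl, one_pow, coeff_zero,
    coeff_sum] at hc
  obtain ⟨i, hi, hne⟩ : ∃ i ∈ Finset.Icc 1 m,
      coeff (m • d) (e i * monomial d (1 : 𝕜) ^ (m - i)) ≠ 0 := by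
    by_contra! hzero
    rw [Finset.sum_eq_zero hzero] at hc
    simp at hc
  have him := Finset.mem_Icc.1 hi
  have hmd : m • d = i • d + (m - i) • d := by
    rw [← add_smul, Nat.add_sub_cancel' him.2]
  rw [monomial_pow, one_pow, hmd, coeff_mul_monomial, mul_one] at hne
  have := pow_le_weightIdeal hJ i (he i hi) (i • d) (mem_support_iff.2 hne)
  simp only [Finsupp.smul_apply, smul_eq_mul, Nat.cast_mul, mul_assoc] at this
  rw [← Finset.mul_sum] at this
  exact le_of_mul_le_mul_left this (by exact_mod_cast him.1)

theorem span_prod_X_le_weightIdeal {S : Set (Finset (Fin n))} {y : Fin n → ℝ}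
    (hy : y ∈ coveringWeights S) :
    Ideal.span ((fun s => ∏ i ∈ s, (X i : MvPolynomial (Fin n) 𝕜)) '' S) ≤
      weightIdeal 𝕜 y hy.1 1 := by
  classical
  rw [Ideal.span_le]
  rintro _ ⟨E, hE, rfl⟩ u hu
  have hprod : (∏ i ∈ E, (X i : MvPolynomial (Fin n) 𝕜)) =
      monomial (∑ i ∈ E, Finsupp.single i 1) 1 := by
    rw [monomial_sum_one]
    rfl
  simp only [hprod] at hu
  have := Finset.mem_singleton.1 (support_monomial_subset hu)
  subst this
  refine (hy.2 E hE).trans (le_of_eq ?_)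
  simp [Finsupp.finsetSum_apply, Finsupp.single_apply]

/-! ### Integral closure of ideals -/

theorem mem_idealIntegralClosure_of_isIntegral {R : Type*} [CommRing R] {J : Ideal R} {x : R}
    (h : IsIntegral (reesAlgebra J) (Polynomial.monomial 1 x)) :
    x ∈ idealIntegralClosure J := by
  obtain ⟨P, hP, hPx⟩ := h
  rcases Nat.eq_zero_or_pos P.natDegree with h0 | hpos
  · have hP1 : P = 1 := hP.natDegree_eq_zero.1 h0
    subst hP1
    simp only [Polynomial.eval₂_one] at hPx
    have : Subsingleton R := by
      have h1 := congrArg (Polynomial.coeff · 0) hPx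
      simp only [Polynomial.coeff_one_zero, Polynomial.coeff_zero] at h1
      exact subsingleton_of_zero_eq_one h1.symm
    exact ⟨1, one_pos, 0, fun i _ => Ideal.zero_mem _, Subsingleton.elim _ _⟩
  · set m := P.natDegree with hm
    refine ⟨m, hpos, fun i => ((P.coeff (m - i) : reesAlgebra J) : Polynomial R).coeff i,
      fun i _ => (P.coeff (m - i)).2 i, ?_⟩
    rw [Polynomial.eval₂_eq_sum_range, Finset.sum_range_succ, ← hm, hP.coeff_natDegree,
      map_one, one_mul] at hPx
    have hc := congrArg (Polynomial.coeff · m) hPx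
    simp only [Polynomial.coeff_add, Polynomial.finsetSum_coeff, Polynomial.monomial_pow,
      one_mul, Polynomial.coeff_monomial, if_true, Polynomial.coeff_zero] at hc
    rw [add_comm, ← hc]
    congr 1
    refine Finset.sum_bij' (fun i _ => m - i) (fun i _ => m - i) ?_ ?_ ?_ ?_ ?_
    · intro i hi
      simp only [Finset.mem_Icc, Finset.mem_range] at *
      omega
    · intro i hi
      simp only [Finset.mem_Icc, Finset.mem_range] at *
      omega
    · intro i hi
      simp only [Finset.mem_Icc] at *
      omega
    · intro i hi
      simp only [Finset.mem_range] at *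
      omega
    · intro i hi
      simp only [Finset.mem_Icc] at hi
      have := Polynomial.coeff_mul_monomial
        ((P.coeff (m - i) : reesAlgebra J) : Polynomial R) (m - i) i (x ^ (m - i))
      rw [Nat.add_sub_cancel' hi.2] at this
      exact this.symm

theorem isIntegral_monomial_of_pow_mem {R : Type*} [CommRing R] {J : Ideal R} {x : R} {N : ℕ}
    (hN : 0 < N) (h : x ^ N ∈ J ^ N) :
    IsIntegral (reesAlgebra J) (Polynomial.monomial 1 x) := by
  refine IsIntegral.of_pow hN ?_
  rw [Polynomial.monomial_pow, one_mul]
  exact isIntegral_algebraMap (A := Polynomial R)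
    (x := (⟨Polynomial.monomial N (x ^ N), reesAlgebra.monomial_mem.2 h⟩ : reesAlgebra J))

/-- A polynomial each of whose monomials has a power in the same power of `J` is integral
over `J`. -/
theorem mem_idealIntegralClosure_of_support {J : Ideal (MvPolynomial (Fin n) 𝕜)}
    {f : MvPolynomial (Fin n) 𝕜}
    (h : ∀ u ∈ f.support, ∃ N : ℕ, 0 < N ∧ monomial (N • u) (1 : 𝕜) ∈ J ^ N) :
    f ∈ idealIntegralClosure J := by
  refine mem_idealIntegralClosure_of_isIntegral ?_
  rw [f.as_sum, map_sum]
  refine IsIntegral.sum _ fun u hu => ?_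
  obtain ⟨N, hN, hmem⟩ := h u hu
  refine isIntegral_monomial_of_pow_mem hN ?_
  rw [monomial_pow, show coeff u f ^ N = coeff u f ^ N * 1 from (mul_one _).symm,
    ← C_mul_monomial]
  exact Ideal.mul_mem_left _ _ hmem

/-! ### Associated primes of squarefree monomial ideals -/

/-- The sets of variables lying in the associated primes of `I`. -/
def associatedVarSets (I : Ideal (MvPolynomial (Fin n) 𝕜)) : Set (Finset (Fin n)) :=
  open Classical in
  {C | ∃ p ∈ associatedPrimes (MvPolynomial (Fin n) 𝕜) (MvPolynomial (Fin n) 𝕜 ⧸ I),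
    C = Finset.univ.filter (fun i => (X i : MvPolynomial (Fin n) 𝕜) ∈ p)}

theorem alexanderDual_eq_span (I : Ideal (MvPolynomial (Fin n) 𝕜)) :
    alexanderDual I = Ideal.span ((fun s => ∏ i ∈ s, X i) '' associatedVarSets I) := by
  unfold alexanderDual associatedVarSets
  congr 1
  ext f
  simp only [Set.mem_image, Set.mem_ofPred_eq]
  constructor
  · rintro ⟨p, hp, rfl⟩
    exact ⟨_, ⟨p, hp, rfl⟩, rfl⟩
  · rintro ⟨_, ⟨p, hp, rfl⟩, rfl⟩
    exact ⟨p, hp, rfl⟩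

theorem isPrime_span_X_image (D : Set (Fin n)) :
    (Ideal.span (X '' D : Set (MvPolynomial (Fin n) 𝕜))).IsPrime := by
  classical
  set P := Ideal.span (X '' D : Set (MvPolynomial (Fin n) 𝕜)) with hP
  let φ : MvPolynomial (Fin n) 𝕜 →ₐ[𝕜] MvPolynomial (Fin n) 𝕜 :=
    aeval fun i => if i ∈ D then 0 else X i
  have hφ : (Ideal.Quotient.mkₐ 𝕜 P).comp φ = Ideal.Quotient.mkₐ 𝕜 P := by
    ext i
    simp only [φ, AlgHom.comp_apply, aeval_X]
    split_ifs with h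
    · rw [map_zero]
      exact (Ideal.Quotient.eq_zero_iff_mem.2 (Ideal.subset_span (Set.mem_image_of_mem _ h))).symm
    · rfl
  have hker : P = RingHom.ker φ := by
    apply le_antisymm
    · rw [hP, Ideal.span_le]
      rintro _ ⟨i, hi, rfl⟩
      simp [φ, RingHom.mem_ker, hi]
    · intro f hf
      have := AlgHom.congr_fun hφ f
      rw [AlgHom.comp_apply, (RingHom.mem_ker).1 hf, map_zero] at this
      exact Ideal.Quotient.eq_zero_iff_mem.1 this.symm
  rw [hker]
  exact RingHom.ker_isPrime _

theorem span_prod_X_le_of_cover {S : Set (Finset (Fin n))} {D : Set (Fin n)}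
    {p : Ideal (MvPolynomial (Fin n) 𝕜)} (hp : ∀ i ∈ D, X i ∈ p) (hD : ∀ E ∈ S, ∃ i ∈ E, i ∈ D) :
    Ideal.span ((fun s => ∏ i ∈ s, X i) '' S) ≤ p := by
  rw [Ideal.span_le]
  rintro _ ⟨E, hE, rfl⟩
  obtain ⟨i, hiE, hiD⟩ := hD E hE
  exact Ideal.mem_of_dvd _ (Finset.dvd_prod_of_mem _ hiE) (hp i hiD)

/-- A squarefree monomial ideal contains every polynomial lying in all coordinate primes that
contain it. -/
theorem mem_span_prod_X_of_forall_cover {S : Set (Finset (Fin n))}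
    {f : MvPolynomial (Fin n) 𝕜}
    (h : ∀ D : Set (Fin n), (∀ E ∈ S, ∃ i ∈ E, i ∈ D) →
      f ∈ Ideal.span (X '' D : Set (MvPolynomial (Fin n) 𝕜))) :
    f ∈ Ideal.span ((fun s => ∏ i ∈ s, X i) '' S) := by
  classical
  have himg : ((fun s => ∏ i ∈ s, (X i : MvPolynomial (Fin n) 𝕜)) '' S) =
      (fun d => monomial d (1 : 𝕜)) ''
        ((fun E : Finset (Fin n) => ∑ i ∈ E, Finsupp.single i 1) '' S) := by
    rw [Set.image_image]
    refine Set.image_congr fun E _ => ?_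
    rw [monomial_sum_one]
    rfl
  rw [himg, mem_ideal_span_monomial_image]
  intro u hu
  by_contra! hno
  obtain ⟨i, hi, hne⟩ := mem_ideal_span_X_image.1 (h {i | u i = 0} (by
    intro E hE
    by_contra! hE'
    refine hno _ ⟨E, hE, rfl⟩ fun i => ?_
    by_cases hi : i ∈ E
    · simpa [Finsupp.finsetSum_apply, Finsupp.single_apply, hi] using
        Nat.one_le_iff_ne_zero.2 (hE' i hi)
    · simp [Finsupp.finsetSum_apply, Finsupp.single_apply, hi])) u hu
  exact hne hi

theorem le_of_mem_associatedPrimes {R : Type*} [CommRing R] [IsNoetherianRing R] {I p : Ideal R}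
    (hp : p ∈ associatedPrimes R (R ⧸ I)) : I ≤ p := by
  intro x hx
  refine hp.annihilator_le ?_
  rwa [Submodule.annihilator_top, Ideal.annihilator_quotient]

/-- The associated primes of a squarefree monomial ideal are generated by variables. -/
theorem associatedPrime_le_span_X {S : Set (Finset (Fin n))}
    {p : Ideal (MvPolynomial (Fin n) 𝕜)}
    (hp : p ∈ associatedPrimes (MvPolynomial (Fin n) 𝕜)
      (MvPolynomial (Fin n) 𝕜 ⧸
        Ideal.span ((fun s => ∏ i ∈ s, (X i : MvPolynomial (Fin n) 𝕜)) '' S))) :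
    p ≤ Ideal.span (X '' {i | X i ∈ p}) := by
  have hprime : p.IsPrime := hp.isPrime
  have hIp := le_of_mem_associatedPrimes hp
  have hcov : ∀ E ∈ S, ∃ i ∈ E, i ∈ {i : Fin n | (X i : MvPolynomial (Fin n) 𝕜) ∈ p} := by
    intro E hE
    exact (hprime.prod_mem_iff).1 (hIp (Ideal.subset_span ⟨E, hE, rfl⟩))
  obtain ⟨-, z, hz⟩ := isAssociatedPrime_iff.1 hp
  obtain ⟨f, rfl⟩ := Ideal.Quotient.mk_surjective z
  have hmem : ∀ g, g ∈ p ↔ g * f ∈ Ideal.span ((fun s => ∏ i ∈ s, X i) '' S) := by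
    intro g
    rw [hz, Submodule.mem_colon_singleton, Submodule.mem_bot, ← Ideal.Quotient.eq_zero_iff_mem,
      map_mul]
    rfl
  have hle : Ideal.span (X '' {i : Fin n | (X i : MvPolynomial (Fin n) 𝕜) ∈ p}) ≤ p := by
    rw [Ideal.span_le]
    rintro _ ⟨i, hi, rfl⟩
    exact hi
  have hfp : f ∉ p := by
    intro hf
    have hff := (hmem f).1 hf
    have hfI : f ∈ Ideal.span ((fun s => ∏ i ∈ s, (X i : MvPolynomial (Fin n) 𝕜)) '' S) := by
      refine mem_span_prod_X_of_forall_cover fun D hD => ?_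
      have := span_prod_X_le_of_cover (fun i hi => Ideal.subset_span (Set.mem_image_of_mem _ hi)) hD hff
      exact ((isPrime_span_X_image D).mem_or_mem this).elim id id
    exact hprime.ne_top ((Ideal.eq_top_iff_one _).2 ((hmem 1).2 (by rwa [one_mul])))
  intro g hg
  have := span_prod_X_le_of_cover (fun i hi => Ideal.subset_span (Set.mem_image_of_mem _ hi)) hcov
    ((hmem g).1 hg)
  exact ((isPrime_span_X_image _).mem_or_mem this).resolve_right fun h => hfp (hle h)

theorem associatedVarSets_cover {S : Set (Finset (Fin n))} {C : Finset (Fin n)}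
    (hC : C ∈ associatedVarSets
      (Ideal.span ((fun s => ∏ i ∈ s, (X i : MvPolynomial (Fin n) 𝕜)) '' S)))
    {E : Finset (Fin n)} (hE : E ∈ S) : ∃ i ∈ E, i ∈ C := by
  obtain ⟨p, hp, rfl⟩ := hC
  have hprime : p.IsPrime := hp.isPrime
  obtain ⟨i, hi, hip⟩ := (hprime.prod_mem_iff).1
    (le_of_mem_associatedPrimes hp (Ideal.subset_span ⟨E, hE, rfl⟩))
  exact ⟨i, hi, by simpa using hip⟩

/-- Every cover of `S` contains the set of variables of some associated prime. -/
theorem exists_associatedVarSet_subset (S : Set (Finset (Fin n))) {D : Finset (Fin n)}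
    (hD : ∀ E ∈ S, ∃ i ∈ E, i ∈ D) :
    ∃ C ∈ associatedVarSets
      (Ideal.span ((fun s => ∏ i ∈ s, (X i : MvPolynomial (Fin n) 𝕜)) '' S)), C ⊆ D := by
  set I := Ideal.span ((fun s => ∏ i ∈ s, (X i : MvPolynomial (Fin n) 𝕜)) '' S) with hI
  have := isPrime_span_X_image (𝕜 := 𝕜) (D : Set (Fin n))
  obtain ⟨p, hp, hpD⟩ := Ideal.exists_minimalPrimes_le (I := I)
    (span_prod_X_le_of_cover (D := (D : Set (Fin n)))
      (fun i hi => Ideal.subset_span (Set.mem_image_of_mem _ hi)) hD)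
  refine ⟨_, ⟨p, Module.associatedPrimes.minimalPrimes_annihilator_subset_associatedPrimes _ _ ?_, rfl⟩, ?_⟩
  · rwa [Ideal.annihilator_quotient]
  · intro i hi
    have hiP := hpD (by simpa using hi : X i ∈ p)
    rw [mem_ideal_span_X_image] at hiP
    obtain ⟨j, hj, hne⟩ := hiP (Finsupp.single i 1) (by simp [support_X])
    have : i = j := by
      by_contra hij
      simp [hij] at hne
    rwa [this]

/-- Covering weights do not distinguish a family from the family of associated variable sets of
the ideal generated by its associated variable sets. -/
theorem coveringWeights_associatedVarSets_dual (S : Set (Finset (Fin n))) :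
    coveringWeights (associatedVarSets (alexanderDual
      (Ideal.span ((fun s => ∏ i ∈ s, (X i : MvPolynomial (Fin n) 𝕜)) '' S)))) =
      coveringWeights S := by
  classical
  set A := associatedVarSets
    (Ideal.span ((fun s => ∏ i ∈ s, (X i : MvPolynomial (Fin n) 𝕜)) '' S)) with hA
  rw [alexanderDual_eq_span, ← hA]
  ext y
  refine and_congr_right fun hy => ⟨fun h E hE => ?_, fun h E' hE' => ?_⟩
  · obtain ⟨E', hE', hsub⟩ := exists_associatedVarSet_subset (𝕜 := 𝕜) A (D := E)
      (fun C hC => (associatedVarSets_cover hC hE).imp fun i hi => hi.symm)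
    exact (h E' hE').trans (Finset.sum_le_sum_of_subset_of_nonneg hsub fun i _ _ => hy i)
  · obtain ⟨E, hE, hsub⟩ : ∃ E ∈ S, E ⊆ E' := by
      by_contra! hno
      obtain ⟨C, hC, hCD⟩ := exists_associatedVarSet_subset (𝕜 := 𝕜) S (D := E'ᶜ) (by
        intro E hE
        obtain ⟨i, hi, hi'⟩ := Finset.not_subset.1 (hno E hE)
        exact ⟨i, hi, Finset.mem_compl.2 hi'⟩)
      obtain ⟨i, hiC, hiE'⟩ := associatedVarSets_cover hE' hC
      exact Finset.mem_compl.1 (hCD hiC) hiE'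
    exact (h E hE).trans (Finset.sum_le_sum_of_subset_of_nonneg hsub fun i _ _ => hy i)

/-! ### Symbolic powers -/

theorem monomial_mem_pow_of_le_sum {p : Ideal (MvPolynomial (Fin n) 𝕜)} {C : Finset (Fin n)}
    (hC : ∀ i ∈ C, X i ∈ p) {u : Fin n →₀ ℕ} {m : ℕ} (hm : m ≤ ∑ i ∈ C, u i) :
    monomial u (1 : 𝕜) ∈ p ^ m := by
  refine Ideal.pow_le_pow_right hm ?_
  rw [← Finset.prod_pow_eq_pow_sum, monomial_eq, C_1, one_mul,
    Finsupp.prod_fintype _ _ (fun i => pow_zero _)]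
  exact Ideal.mem_of_dvd _ (Finset.prod_dvd_prod_of_subset _ _ _ (Finset.subset_univ C))
    (Ideal.prod_mem_prod fun i hi => Ideal.pow_mem_pow (hC i hi) _)

theorem monomial_mem_symbolicPower {I : Ideal (MvPolynomial (Fin n) 𝕜)} {u : Fin n →₀ ℕ} {m : ℕ}
    (h : ∀ C ∈ associatedVarSets I, m ≤ ∑ i ∈ C, u i) :
    monomial u (1 : 𝕜) ∈ symbolicPower I m := by
  simp only [symbolicPower, Submodule.mem_iInf]
  intro p hp
  exact monomial_mem_pow_of_le_sum (by simp) (h _ ⟨p, hp, rfl⟩)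

theorem le_sum_of_mem_symbolicPower {S : Set (Finset (Fin n))} {f : MvPolynomial (Fin n) 𝕜}
    {m : ℕ} (hf : f ∈ symbolicPower (Ideal.span ((fun s => ∏ i ∈ s, X i) '' S)) m)
    {u : Fin n →₀ ℕ} (hu : u ∈ f.support) {C : Finset (Fin n)}
    (hC : C ∈ associatedVarSets
      (Ideal.span ((fun s => ∏ i ∈ s, (X i : MvPolynomial (Fin n) 𝕜)) '' S))) :
    m ≤ ∑ i ∈ C, u i := by
  classical
  obtain ⟨p, hp, hCp⟩ := hC
  simp only [symbolicPower, Submodule.mem_iInf] at hf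
  have hmem : ∀ i, i ∈ C ↔ (X i : MvPolynomial (Fin n) 𝕜) ∈ p := by simp [hCp]
  let y : Fin n → ℝ := fun i => if i ∈ C then 1 else 0
  have hy : ∀ i, 0 ≤ y i := fun i => by
    simp only [y]
    split_ifs <;> norm_num
  have hle : p ≤ weightIdeal 𝕜 y hy 1 := by
    refine (associatedPrime_le_span_X hp).trans (Ideal.span_le.2 ?_)
    rintro _ ⟨i, hi, rfl⟩ v hv
    rw [support_X, Finset.mem_singleton] at hv
    subst hv
    simp [y, Finsupp.single_apply, (hmem i).2 hi]
  have := pow_le_weightIdeal hle m (hf p hp) u hu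
  simp only [y, mul_one, mul_ite, mul_zero, Finset.sum_ite_mem, Finset.univ_inter] at this
  exact_mod_cast this

/-! ### Noncontainment and pairs of covering weights -/

theorem eventually_not_subset_of_coveringWeights {S : Set (Finset (Fin n))}
    {I : Ideal (MvPolynomial (Fin n) 𝕜)} (hI : I = Ideal.span ((fun s => ∏ i ∈ s, X i) '' S))
    {x y : Fin n → ℝ} (hx : x ∈ coveringWeights (associatedVarSets I))
    (hy : y ∈ coveringWeights S) {s r : ℕ} (hxy : s * ∑ i, x i * y i < (r : ℝ)) :
    ∀ᶠ t : ℕ in atTop,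
      ¬ ((symbolicPower I (s * t) : Set (MvPolynomial (Fin n) 𝕜)) ⊆
        idealIntegralClosure (I ^ (r * t))) := by
  set δ := (r : ℝ) - s * ∑ i, x i * y i with hδ
  have hδ0 : 0 < δ := by linarith
  obtain ⟨T, hT⟩ := exists_nat_gt ((∑ i, y i) / δ)
  filter_upwards [eventually_ge_atTop T] with t ht hsub
  let d : Fin n →₀ ℕ := Finsupp.equivFunOnFinite.symm fun i => ⌈(s : ℝ) * t * x i⌉₊
  have hd : ∀ i, d i = ⌈(s : ℝ) * t * x i⌉₊ := fun i => rfl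
  have hdmem : monomial d (1 : 𝕜) ∈ symbolicPower I (s * t) := by
    refine monomial_mem_symbolicPower fun C hC => ?_
    have h1 : (s : ℝ) * t ≤ ∑ i ∈ C, (d i : ℝ) := by
      calc (s : ℝ) * t ≤ s * t * ∑ i ∈ C, x i :=
            le_mul_of_one_le_right (by positivity) (hx.2 C hC)
        _ = ∑ i ∈ C, s * t * x i := Finset.mul_sum _ _ _
        _ ≤ _ := Finset.sum_le_sum fun i _ => by rw [hd]; exact Nat.le_ceil _
    exact_mod_cast h1
  have hle : I ^ (r * t) ≤ weightIdeal 𝕜 y hy.1 ((r * t : ℕ) * 1) :=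
    pow_le_weightIdeal (hI ▸ span_prod_X_le_weightIdeal hy) _
  have h1 := le_weight_of_monomial_mem_idealIntegralClosure hle (hsub hdmem)
  have h2 : ∑ i, (d i : ℝ) * y i ≤ ∑ i, (s * t * x i + 1) * y i := by
    refine Finset.sum_le_sum fun i _ => mul_le_mul_of_nonneg_right ?_ (hy.1 i)
    rw [hd]
    exact (Nat.ceil_lt_add_one (mul_nonneg (by positivity) (hx.1 i))).le
  have h3 : ∑ i, ((s : ℝ) * t * x i + 1) * y i = t * (s * ∑ i, x i * y i) + ∑ i, y i := by
    rw [Finset.mul_sum, Finset.mul_sum, ← Finset.sum_add_distrib]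
    exact Finset.sum_congr rfl fun i _ => by ring
  have h4 : ∑ i, y i < t * δ := by
    have : (∑ i, y i) / δ < t := hT.trans_le (by exact_mod_cast ht)
    rwa [div_lt_iff₀ hδ0] at this
  push_cast at h1
  rw [hδ] at h4
  nlinarith

/-- A monomial whose exponent dominates more than `k` times a convex combination of exponents of
generators has a power in the corresponding power of the `k`-th power of the ideal. -/
theorem exists_monomial_nsmul_mem_pow {S : Set (Finset (Fin n))} {u : Fin n →₀ ℕ} {k : ℕ}
    {ρ : ℝ} (hρ : k < ρ) {ι : Type} [Fintype ι] {w : ι → ℝ} {E : ι → Finset (Fin n)}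
    (hw0 : ∀ j, 0 ≤ w j) (hw1 : ∑ j, w j = 1) (hE : ∀ j, E j ∈ S)
    (hle : ∀ i, ρ * ∑ j, (if i ∈ E j then w j else 0) ≤ u i) :
    ∃ N : ℕ, 0 < N ∧ monomial (N • u) (1 : 𝕜) ∈
      (Ideal.span ((fun s => ∏ i ∈ s, (X i : MvPolynomial (Fin n) 𝕜)) '' S) ^ k) ^ N := by
  classical
  set I := Ideal.span ((fun s => ∏ i ∈ s, (X i : MvPolynomial (Fin n) 𝕜)) '' S)
  have hρ0 : 0 ≤ ρ := (Nat.cast_nonneg k).trans hρ.le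
  obtain ⟨N, hN⟩ := exists_nat_gt ((Fintype.card ι : ℝ) / (ρ - k))
  have hN' : (Fintype.card ι : ℝ) < N * (ρ - k) := by
    rwa [div_lt_iff₀ (by linarith)] at hN
  have hN0 : 0 < N := by
    rcases Nat.eq_zero_or_pos N with h | h
    · subst h
      have : (0 : ℝ) ≤ Fintype.card ι := Nat.cast_nonneg _
      simp only [Nat.cast_zero, zero_mul] at hN'
      linarith
    · exact h
  refine ⟨N, hN0, ?_⟩
  let e : ι → ℕ := fun j => ⌊N * ρ * w j⌋₊
  have he : k * N ≤ ∑ j, e j := by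
    have h1 : ∑ j, (N * ρ * w j - 1) ≤ ∑ j, (e j : ℝ) :=
      Finset.sum_le_sum fun j _ => (Nat.sub_one_lt_floor _).le
    rw [Finset.sum_sub_distrib, ← Finset.mul_sum, hw1] at h1
    simp only [Finset.sum_const, Finset.card_univ, nsmul_eq_mul, mul_one] at h1
    have h2 : (k : ℝ) * N ≤ ∑ j, (e j : ℝ) := by linarith
    exact_mod_cast h2
  rw [← pow_mul]
  refine Ideal.pow_le_pow_right he ?_
  have hprod : ∏ j, (∏ i ∈ E j, (X i : MvPolynomial (Fin n) 𝕜)) ^ e j ∈ I ^ ∑ j, e j := by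
    rw [← Finset.prod_pow_eq_pow_sum]
    exact Ideal.prod_mem_prod fun j _ =>
      Ideal.pow_mem_pow (Ideal.subset_span (Set.mem_image_of_mem _ (hE j))) _
  refine Ideal.mem_of_dvd _ ?_ hprod
  have hrw : ∏ j, (∏ i ∈ E j, (X i : MvPolynomial (Fin n) 𝕜)) ^ e j =
      ∏ i, X i ^ ∑ j, (if i ∈ E j then e j else 0) := by
    have : ∀ j, (∏ i ∈ E j, (X i : MvPolynomial (Fin n) 𝕜)) ^ e j =
        ∏ i, X i ^ (if i ∈ E j then e j else 0) := by
      intro j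
      rw [← Finset.prod_pow, ← Finset.prod_subset (Finset.subset_univ (E j))
        (fun i _ hi => by simp [hi])]
      exact Finset.prod_congr rfl fun i hi => by simp [hi]
    simp_rw [this]
    rw [Finset.prod_comm]
    simp_rw [Finset.prod_pow_eq_pow_sum]
  rw [hrw, monomial_eq, C_1, one_mul, Finsupp.prod_fintype _ _ (fun i => pow_zero _)]
  refine Finset.prod_dvd_prod_of_dvd _ _ fun i _ => pow_dvd_pow _ ?_
  have h1 : (∑ j, (if i ∈ E j then (e j : ℝ) else 0)) ≤ N * u i := by
    calc (∑ j, (if i ∈ E j then (e j : ℝ) else 0))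
        ≤ ∑ j, N * ρ * (if i ∈ E j then w j else 0) := by
          refine Finset.sum_le_sum fun j _ => ?_
          split_ifs
          · exact Nat.floor_le (mul_nonneg (by positivity) (hw0 j))
          · simp
      _ = N * (ρ * ∑ j, (if i ∈ E j then w j else 0)) := by
          rw [← Finset.mul_sum, mul_assoc]
      _ ≤ N * u i := mul_le_mul_of_nonneg_left (hle i) (Nat.cast_nonneg _)
  simp only [Finsupp.smul_apply, smul_eq_mul]
  exact_mod_cast h1

theorem exists_coveringWeights_of_not_subset {S : Set (Finset (Fin n))}
    {I : Ideal (MvPolynomial (Fin n) 𝕜)} (hI : I = Ideal.span ((fun s => ∏ i ∈ s, X i) '' S))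
    {s r t : ℕ} (hs : 1 ≤ s) (ht : 1 ≤ t)
    (h : ¬ ((symbolicPower I (s * t) : Set (MvPolynomial (Fin n) 𝕜)) ⊆
        idealIntegralClosure (I ^ (r * t)))) {ρ : ℝ} (hρ : r < ρ) :
    ∃ x ∈ coveringWeights (associatedVarSets I), ∃ y ∈ coveringWeights S,
      s * ∑ i, x i * y i < ρ := by
  subst hI
  obtain ⟨f, hf, hfcl⟩ := Set.not_subset.1 h
  have hs0 : (0 : ℝ) < s := by exact_mod_cast hs
  have ht0 : (0 : ℝ) < t := by exact_mod_cast ht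
  have hρ0 : 0 < ρ := (Nat.cast_nonneg r).trans_lt hρ
  by_contra! hno
  refine hfcl (mem_idealIntegralClosure_of_support fun u hu => ?_)
  have hx : (fun i => (u i : ℝ) / (s * t)) ∈ coveringWeights (associatedVarSets
      (Ideal.span ((fun s => ∏ i ∈ s, (X i : MvPolynomial (Fin n) 𝕜)) '' S))) := by
    refine ⟨fun i => by positivity, fun C hC => ?_⟩
    rw [← Finset.sum_div, le_div_iff₀ (by positivity), one_mul]
    exact_mod_cast le_sum_of_mem_symbolicPower hf hu hC
  obtain ⟨ι, _, w, E, hw0, hw1, hE, hle⟩ := exists_convexCombination_indicator_le (S := S)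
    (u := fun i => (u i : ℝ) / (ρ * t)) (fun i => by positivity) (by
      intro y hy
      have := hno _ hx y hy
      have h1 : ∑ i, (u i : ℝ) / (ρ * t) * y i = (s * ∑ i, (u i : ℝ) / (s * t) * y i) / ρ := by
        rw [Finset.mul_sum, Finset.sum_div]
        exact Finset.sum_congr rfl fun i _ => by field_simp
      rwa [h1, le_div_iff₀ hρ0, one_mul])
  refine exists_monomial_nsmul_mem_pow (ρ := ρ * t) ?_ hw0 hw1 hE fun i => ?_
  · push_cast
    exact mul_lt_mul_of_pos_right hρ ht0
  · have := hle i
    rwa [le_div_iff₀ (by positivity), mul_comm] at this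

/-- If the covering-weight pairs governing `I` are, up to swapping, among those governing `J`,
then the asymptotic resurgence of `I` is at most that of `J`. -/
theorem asymptoticResurgence_le_of_coveringWeights {S T : Set (Finset (Fin n))}
    {I J : Ideal (MvPolynomial (Fin n) 𝕜)}
    (hI : I = Ideal.span ((fun s => ∏ i ∈ s, X i) '' S))
    (hJ : J = Ideal.span ((fun s => ∏ i ∈ s, X i) '' T))
    (hIT : coveringWeights (associatedVarSets I) ⊆ coveringWeights T)
    (hSJ : coveringWeights S ⊆ coveringWeights (associatedVarSets J)) :
    asymptoticResurgence (symbolicPower I) (fun t => idealIntegralClosure (I ^ t)) ≤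
      asymptoticResurgence (symbolicPower J) (fun t => idealIntegralClosure (J ^ t)) := by
  refine sSup_le ?_
  rintro _ ⟨s, r, hs, hr, hev, rfl⟩
  have hlim : Tendsto (fun k : ℕ => (((s : ℝ) / (r + 1 / ((k : ℝ) + 1)) : ℝ) : EReal)) atTop
      (nhds (((s : ℝ) / (r : ℝ) : ℝ) : EReal)) := by
    refine (continuous_coe_real_ereal.tendsto _).comp ?_
    have h1 : Tendsto (fun k : ℕ => (r : ℝ) + 1 / ((k : ℝ) + 1)) atTop (nhds (r + 0)) :=
      tendsto_const_nhds.add tendsto_one_div_add_atTop_nhds_zero_nat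
    rw [add_zero] at h1
    exact tendsto_const_nhds.div h1 (by positivity)
  refine le_of_tendsto' hlim fun k => le_sSup ?_
  obtain ⟨t, htn, ht⟩ := (hev.and (eventually_ge_atTop 1)).exists
  obtain ⟨x, hx, y, hy, hxy⟩ := exists_coveringWeights_of_not_subset hI hs ht htn
    (ρ := r + 1 / ((k : ℝ) + 1)) (lt_add_of_pos_right _ (by positivity))
  refine ⟨s * (k + 1), r * (k + 1) + 1, Nat.mul_pos hs k.succ_pos, by omega,
    eventually_not_subset_of_coveringWeights hJ (hSJ hy) (hIT hx) ?_, ?_⟩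
  · have hk : (0 : ℝ) < (k : ℝ) + 1 := by positivity
    have h1 := mul_lt_mul_of_pos_right hxy hk
    have h2 : ((r : ℝ) + 1 / ((k : ℝ) + 1)) * (k + 1) = r * (k + 1) + 1 := by field_simp
    have h3 : ∑ i, y i * x i = ∑ i, x i * y i := Finset.sum_congr rfl fun i _ => mul_comm _ _
    rw [h2] at h1
    rw [h3]
    push_cast
    linarith
  · congr 1
    push_cast
    field_simp

/-- Corollary `cor.rhatV`, second part. For a nonzero proper squarefree
monomial ideal `a`, `ρ̂(a^{(•)}, overline(a^•)) = ρ̂((a^∨)^{(•)}, overline((a^∨)^•))`. -/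
theorem asymptoticResurgence_symbolic_alexanderDual
    (a : Ideal (MvPolynomial (Fin n) 𝕜))
    (haSqf : IsSqfreeMonomialIdeal a) (ha0 : a ≠ ⊥) (ha1 : a ≠ ⊤) :
    asymptoticResurgence (symbolicPower a) (fun t => idealIntegralClosure (a ^ t)) =
      asymptoticResurgence (symbolicPower (alexanderDual a))
        (fun t => idealIntegralClosure ((alexanderDual a) ^ t)) := by
  obtain ⟨S, hS⟩ := haSqf
  have hdual : coveringWeights (associatedVarSets (alexanderDual a)) = coveringWeights S := by
    rw [hS]
    exact coveringWeights_associatedVarSets_dual S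
  exact le_antisymm
    (asymptoticResurgence_le_of_coveringWeights hS (alexanderDual_eq_span a)
      subset_rfl hdual.ge)
    (asymptoticResurgence_le_of_coveringWeights (alexanderDual_eq_span a) hS
      hdual.le subset_rfl)

end
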